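/- Let w be a weight on ℝ^{n+1} and assume there exists a constant C₁ > 0 such that ∫_{R^−} M^+(w χ_{R^−}) ≤ C₁ ∫_{R^+} w for every parabolic rectangle R. Then there exists a constant C₂ > 0 such that ∫_{R^−} w log^+(w/w_{R^+}) ≤ C₂ w(R^+) for every parabolic rectangle R ⊂ ℝ^{n+1}, where log^+ s = max{log s, 0}. -/

import Mathlib

open MeasureTheory Set ENNReal

noncomputable section

/-- The spatial cube `Q(x,L)` with center `x` and side length `L`. -/
def parQ (n : ℕ) (x : Fin n → ℝ) (L : ℝ) : Set (Fin n → ℝ) :=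
  {y | ∀ i, |y i - x i| ≤ L / 2}

/-- Lower part `R^-(γ)` of the parabolic rectangle `R(x,t,L)`. -/
def pMinus (n : ℕ) (p γ : ℝ) (x : Fin n → ℝ) (t L : ℝ) : Set ((Fin n → ℝ) × ℝ) :=
  (parQ n x L) ×ˢ Set.Ioo (t - L ^ p) (t - γ * L ^ p)

/-- Upper part `R^+(γ)` of the parabolic rectangle `R(x,t,L)`. -/
def pPlus (n : ℕ) (p γ : ℝ) (x : Fin n → ℝ) (t L : ℝ) : Set ((Fin n → ℝ) × ℝ) :=
  (parQ n x L) ×ˢ Set.Ioo (t + γ * L ^ p) (t + L ^ p)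

/-- The full parabolic rectangle `R(x,t,L)`. -/
def pRect (n : ℕ) (p : ℝ) (x : Fin n → ℝ) (t L : ℝ) : Set ((Fin n → ℝ) × ℝ) :=
  (parQ n x L) ×ˢ Set.Ioo (t - L ^ p) (t + L ^ p)

/-- A weight: a nonnegative locally integrable function on `ℝ^{n+1}`. -/
def IsWeight (n : ℕ) (w : (Fin n → ℝ) × ℝ → ℝ) : Prop :=
  (∀ z, 0 ≤ w z) ∧ MeasureTheory.LocallyIntegrable w volume

/-- The uncentered forward-in-time parabolic maximal function. -/
def Mplus (n : ℕ) (p : ℝ) (f : (Fin n → ℝ) × ℝ → ℝ) (z : (Fin n → ℝ) × ℝ) : ℝ≥0∞ :=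
  ⨆ (x : Fin n → ℝ) (t : ℝ) (L : ℝ) (_ : 0 < L) (_ : z ∈ pMinus n p 0 x t L),
    ENNReal.ofReal (⨍ y in pPlus n p 0 x t L, |f y|)

open Metric Filter Topology

/-- The closed parabolic box with center `(x, s)`, side length `L` and time length `L ^ p`. -/
def parBox (n : ℕ) (p : ℝ) (x : Fin n → ℝ) (s L : ℝ) : Set ((Fin n → ℝ) × ℝ) :=
  parQ n x L ×ˢ Icc (s - L ^ p / 2) (s + L ^ p / 2)

lemma parQ_eq_closedBall {n : ℕ} (x : Fin n → ℝ) {L : ℝ} (hL : 0 ≤ L) :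
    parQ n x L = closedBall x (L / 2) := by
  ext y
  simp [parQ, dist_pi_le_iff (show (0 : ℝ) ≤ L / 2 by positivity), Real.dist_eq]

lemma volume_parQ_prod {n : ℕ} (x : Fin n → ℝ) {L : ℝ} (hL : 0 ≤ L) (I : Set ℝ) :
    volume (parQ n x L ×ˢ I) = ENNReal.ofReal (L ^ n) * volume I := by
  rw [parQ_eq_closedBall x hL, Measure.volume_eq_prod, Measure.prod_prod,
    Real.volume_pi_closedBall x (by positivity)]
  simp [mul_div_cancel₀]

lemma volume_parBox {n : ℕ} {p : ℝ} (x : Fin n → ℝ) (s : ℝ) {L : ℝ} (hL : 0 ≤ L) :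
    volume (parBox n p x s L) = ENNReal.ofReal (L ^ n * L ^ p) := by
  rw [parBox, volume_parQ_prod x hL, Real.volume_Icc, ENNReal.ofReal_mul (by positivity)]
  ring_nf

/-- The distance `max (2 |x - y|) ((2 |s - t|) ^ (1 / p))`, whose closed balls are the closed
parabolic boxes. -/
@[reducible]
def parMetric (n : ℕ) (p : ℝ) (hp : 1 < p) : PseudoMetricSpace ((Fin n → ℝ) × ℝ) :=
  let φ : (Fin n → ℝ) × ℝ ≃ₜ
      (Fin n → ℝ) × Snowflaking ℝ p⁻¹ (inv_pos.2 (one_pos.trans hp)) (inv_le_one_of_one_le₀ hp.le) :=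
    (Homeomorph.smulOfNeZero (2 : ℝ) two_ne_zero).prodCongr
      ((Homeomorph.smulOfNeZero (2 : ℝ) two_ne_zero).trans Snowflaking.homeomorph.symm)
  φ.isInducing.comapPseudoMetricSpace

lemma parMetric_closedBall {n : ℕ} {p : ℝ} (hp : 1 < p) (z : (Fin n → ℝ) × ℝ) {L : ℝ}
    (hL : 0 ≤ L) : @closedBall _ (parMetric n p hp) z L = parBox n p z.1 z.2 L := by
  have hp0 : 0 < p := one_pos.trans hp
  ext y
  have h1 : dist ((2 : ℝ) • y.1) ((2 : ℝ) • z.1) ≤ L ↔ ∀ i, |y.1 i - z.1 i| ≤ L / 2 := by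
    rw [dist_pi_le_iff hL]
    refine forall_congr' fun i => ?_
    rw [Pi.smul_apply, Pi.smul_apply, Real.dist_eq, smul_eq_mul, smul_eq_mul, ← mul_sub, abs_mul,
      abs_two, le_div_iff₀' two_pos]
  have h2 : dist (2 * y.2) (2 * z.2) ^ p⁻¹ ≤ L ↔
      y.2 ∈ Icc (z.2 - L ^ p / 2) (z.2 + L ^ p / 2) := by
    rw [Real.rpow_inv_le_iff_of_pos dist_nonneg hL hp0, Real.dist_eq, ← mul_sub, abs_mul, abs_two,
      ← le_div_iff₀' two_pos, abs_sub_le_iff, mem_Icc]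
    constructor <;> rintro ⟨_, _⟩ <;> constructor <;> linarith
  change max (dist ((2 : ℝ) • y.1) ((2 : ℝ) • z.1)) (dist (2 * y.2) (2 * z.2) ^ p⁻¹) ≤ L ↔ _
  rw [max_le_iff, h1, h2]
  rfl

lemma parMetric_isUnifLocDoublingMeasure {n : ℕ} {p : ℝ} (hp : 1 < p) :
    @IsUnifLocDoublingMeasure _ (parMetric n p hp) _ (volume : Measure ((Fin n → ℝ) × ℝ)) := by
  let := parMetric n p hp
  refine ⟨⟨Real.toNNReal (2 ^ n * 2 ^ p), ?_⟩⟩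
  filter_upwards [self_mem_nhdsWithin] with ε hε z
  have hε0 : 0 < ε := hε
  rw [parMetric_closedBall hp z (by positivity), parMetric_closedBall hp z hε0.le,
    volume_parBox _ _ (by positivity), volume_parBox _ _ hε0.le]
  change _ ≤ ENNReal.ofReal _ * _
  rw [← ENNReal.ofReal_mul (by positivity), Real.mul_rpow two_pos.le hε0.le]
  apply ENNReal.ofReal_le_ofReal
  apply le_of_eq
  ring

lemma ae_tendsto_average_parBox {n : ℕ} {p : ℝ} (hp : 1 < p) {f : (Fin n → ℝ) × ℝ → ℝ}
    (hf : LocallyIntegrable f) {η : ℝ} (hη : 0 ≤ η) :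
    ∀ᵐ z, Tendsto (fun L : ℝ => ⨍ y in parBox n p z.1 (z.2 + η * L ^ p) L, f y) (𝓝[>] 0)
      (𝓝 (f z)) := by
  have hp0 : 0 < p := one_pos.trans hp
  have key := @IsUnifLocDoublingMeasure.ae_tendsto_average _ (parMetric n p hp) _ volume
    (parMetric_isUnifLocDoublingMeasure hp) inferInstance inferInstance inferInstance ℝ _ _ _ f hf
    ((2 * η) ^ p⁻¹)
  filter_upwards [key] with z hz
  refine (hz (l := 𝓝[>] (0 : ℝ)) (fun L => (z.1, z.2 + η * L ^ p)) (fun L => L) tendsto_id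
    ?_).congr' ?_
  · filter_upwards [self_mem_nhdsWithin] with L hL
    have hL0 : 0 < L := hL
    rw [parMetric_closedBall hp _ (by positivity)]
    refine ⟨fun i => ?_, ?_⟩
    · simp only [sub_self, abs_zero]
      positivity
    · rw [Real.mul_rpow (by positivity) hL0.le, Real.rpow_inv_rpow (by positivity) hp0.ne']
      have : 0 ≤ η * L ^ p := by positivity
      constructor <;> dsimp only <;> linarith
  · filter_upwards [self_mem_nhdsWithin] with L hL
    rw [parMetric_closedBall hp _ (le_of_lt hL)]

section Geometry

variable {n : ℕ} {p : ℝ}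

lemma measurableSet_parQ (x : Fin n → ℝ) (L : ℝ) : MeasurableSet (parQ n x L) := by
  have : parQ n x L = ⋂ i, {y | |y i - x i| ≤ L / 2} := by
    ext y
    simp [parQ]
  rw [this]
  exact MeasurableSet.iInter fun i => measurableSet_le (by fun_prop) (by fun_prop)

lemma measurableSet_pMinus (x : Fin n → ℝ) (t L : ℝ) : MeasurableSet (pMinus n p 0 x t L) :=
  (measurableSet_parQ x L).prod measurableSet_Ioo

lemma measurableSet_pPlus (x : Fin n → ℝ) (t L : ℝ) : MeasurableSet (pPlus n p 0 x t L) :=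
  (measurableSet_parQ x L).prod measurableSet_Ioo

lemma measurableSet_parBox (x : Fin n → ℝ) (t L : ℝ) : MeasurableSet (parBox n p x t L) :=
  (measurableSet_parQ x L).prod measurableSet_Icc

lemma volume_pPlus (x : Fin n → ℝ) (t : ℝ) {L : ℝ} (hL : 0 ≤ L) :
    volume (pPlus n p 0 x t L) = ENNReal.ofReal (L ^ n * L ^ p) := by
  rw [pPlus, volume_parQ_prod x hL, Real.volume_Ioo, ENNReal.ofReal_mul (by positivity)]
  ring_nf

lemma prod_ae_eq_prod {α : Type*} [MeasureSpace α] [SFinite (volume : Measure α)]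
    (A : Set α) {I J : Set ℝ} (h : I =ᵐ[volume] J) : A ×ˢ I =ᵐ[volume] A ×ˢ J := by
  rw [Measure.volume_eq_prod]
  exact Measure.set_prod_ae_eq (ae_eq_refl A) h

lemma pPlus_ae_eq_parBox (x : Fin n → ℝ) (t L : ℝ) :
    pPlus n p 0 x t L =ᵐ[volume] parBox n p x (t + L ^ p / 2) L := by
  have h : Icc (t + L ^ p / 2 - L ^ p / 2) (t + L ^ p / 2 + L ^ p / 2) =
      Icc (t + 0 * L ^ p) (t + L ^ p) := by
    congr 1 <;> ring
  rw [parBox, h]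
  exact prod_ae_eq_prod _ Ioo_ae_eq_Icc

lemma setAverage_parBox (f : (Fin n → ℝ) × ℝ → ℝ) (x : Fin n → ℝ) (s : ℝ) {L : ℝ} (hL : 0 < L) :
    ⨍ y in parBox n p x s L, f y = (∫ y in parBox n p x s L, f y) / (L ^ n * L ^ p) := by
  rw [setAverage_eq, Measure.real, volume_parBox x s hL.le,
    ENNReal.toReal_ofReal (by positivity), smul_eq_mul, inv_mul_eq_div]

lemma setAverage_pPlus (f : (Fin n → ℝ) × ℝ → ℝ) (x : Fin n → ℝ) (t : ℝ) {L : ℝ} (hL : 0 < L) :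
    ⨍ y in pPlus n p 0 x t L, f y = (∫ y in pPlus n p 0 x t L, f y) / (L ^ n * L ^ p) := by
  rw [setAverage_eq, Measure.real, volume_pPlus x t hL.le,
    ENNReal.toReal_ofReal (by positivity), smul_eq_mul, inv_mul_eq_div]

lemma parBox_integrableOn {w : (Fin n → ℝ) × ℝ → ℝ} (hw : LocallyIntegrable w)
    (x : Fin n → ℝ) (s : ℝ) {L : ℝ} (hL : 0 ≤ L) : IntegrableOn w (parBox n p x s L) := by
  refine hw.integrableOn_isCompact ?_
  rw [parBox, parQ_eq_closedBall x hL]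
  exact (isCompact_closedBall x _).prod isCompact_Icc

lemma pPlus_integrableOn {w : (Fin n → ℝ) × ℝ → ℝ} (hw : LocallyIntegrable w)
    (x : Fin n → ℝ) (t : ℝ) {L : ℝ} (hL : 0 ≤ L) : IntegrableOn w (pPlus n p 0 x t L) :=
  (integrableOn_congr_set_ae (pPlus_ae_eq_parBox x t L)).2 (parBox_integrableOn hw x _ hL)

lemma pMinus_eq_pPlus (x : Fin n → ℝ) (t L : ℝ) :
    pMinus n p 0 x t L = pPlus n p 0 x (t - L ^ p) L := by
  simp [pMinus, pPlus]

/-- A point of a cube lies in a subcube of prescribed smaller side length which contains all points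
of the large cube that are close to the given point. -/
lemma exists_parQ_subset {x y : Fin n → ℝ} {L l : ℝ} (hl : 0 ≤ l) (hlL : l ≤ L)
    (hy : y ∈ parQ n x L) :
    ∃ y', y ∈ parQ n y' l ∧ parQ n y' l ⊆ parQ n x L ∧ parQ n y l ∩ parQ n x L ⊆ parQ n y' l := by
  have key : ∀ i, ∃ a : ℝ, |y i - a| ≤ l / 2 ∧ (∀ b, |b - a| ≤ l / 2 → |b - x i| ≤ L / 2) ∧
      ∀ b, |b - y i| ≤ l / 2 → |b - x i| ≤ L / 2 → |b - a| ≤ l / 2 := by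
    intro i
    have hi := abs_le.1 (hy i)
    rcases le_total (y i) (x i + (L - l) / 2) with h1 | h1
    · rcases le_total (x i - (L - l) / 2) (y i) with h2 | h2
      · refine ⟨y i, by rw [sub_self, abs_zero]; positivity, fun b hb => ?_, fun b hb _ => hb⟩
        rw [abs_le] at *
        constructor <;> linarith
      · refine ⟨x i - (L - l) / 2, ?_, fun b hb => ?_, fun b hb hb' => ?_⟩ <;>
          rw [abs_le] at * <;> constructor <;> linarith
    · refine ⟨x i + (L - l) / 2, ?_, fun b hb => ?_, fun b hb hb' => ?_⟩ <;>
        rw [abs_le] at * <;> constructor <;> linarith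
  choose y' h1 h2 h3 using key
  exact ⟨y', h1, fun b hb i => h2 i _ (hb i), fun b hb i => h3 i _ (hb.1 i) (hb.2 i)⟩

end Geometry

section MaximalFunction

variable {n : ℕ} {p : ℝ}

/-- A lower semicontinuous minorant of `Mplus`, where the point is required to lie in the interior
of the lower part of the rectangle. -/
def MplusInterior (n : ℕ) (p : ℝ) (f : (Fin n → ℝ) × ℝ → ℝ) (z : (Fin n → ℝ) × ℝ) : ℝ≥0∞ :=
  ⨆ (x : Fin n → ℝ) (t : ℝ) (L : ℝ) (_ : 0 < L),
    (ball x (L / 2) ×ˢ Ioo (t - L ^ p) t).indicator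
      (fun _ => ENNReal.ofReal (⨍ y in pPlus n p 0 x t L, |f y|)) z

lemma measurable_MplusInterior (f : (Fin n → ℝ) × ℝ → ℝ) : Measurable (MplusInterior n p f) := by
  refine LowerSemicontinuous.measurable ?_
  refine lowerSemicontinuous_iSup fun x => lowerSemicontinuous_iSup fun t =>
    lowerSemicontinuous_iSup fun L => lowerSemicontinuous_iSup fun _ => ?_
  exact (isOpen_ball.prod isOpen_Ioo).lowerSemicontinuous_indicator zero_le

lemma le_Mplus {f : (Fin n → ℝ) × ℝ → ℝ} {z : (Fin n → ℝ) × ℝ} {x : Fin n → ℝ} {t L : ℝ}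
    (hL : 0 < L) (hz : z ∈ pMinus n p 0 x t L) :
    ENNReal.ofReal (⨍ y in pPlus n p 0 x t L, |f y|) ≤ Mplus n p f z :=
  le_iSup_of_le x <| le_iSup_of_le t <| le_iSup_of_le L <| le_iSup_of_le hL <|
    le_iSup_of_le hz le_rfl

lemma le_MplusInterior {f : (Fin n → ℝ) × ℝ → ℝ} {z : (Fin n → ℝ) × ℝ} {x : Fin n → ℝ}
    {t L : ℝ} (hL : 0 < L) (hz : z ∈ ball x (L / 2) ×ˢ Ioo (t - L ^ p) t) :
    ENNReal.ofReal (⨍ y in pPlus n p 0 x t L, |f y|) ≤ MplusInterior n p f z :=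
  le_iSup_of_le x <| le_iSup_of_le t <| le_iSup_of_le L <| le_iSup_of_le hL <| by
    rw [indicator_of_mem hz]

lemma MplusInterior_le_Mplus (f : (Fin n → ℝ) × ℝ → ℝ) (z : (Fin n → ℝ) × ℝ) :
    MplusInterior n p f z ≤ Mplus n p f z := by
  refine iSup_le fun x => iSup_le fun t => iSup_le fun L => iSup_le fun hL => ?_
  refine indicator_apply_le fun hz => le_Mplus hL ⟨?_, ?_⟩
  · rw [parQ_eq_closedBall x hL.le]
    exact ball_subset_closedBall hz.1
  · simpa using hz.2

lemma ae_le_Mplus (hp : 1 < p) {f : (Fin n → ℝ) × ℝ → ℝ} (hf0 : ∀ z, 0 ≤ f z)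
    (hf : LocallyIntegrable f) : ∀ᵐ z, ENNReal.ofReal (f z) ≤ Mplus n p f z := by
  filter_upwards [ae_tendsto_average_parBox hp hf zero_le_one] with z hz
  refine le_of_tendsto ((ENNReal.continuous_ofReal.tendsto _).comp hz) ?_
  filter_upwards [self_mem_nhdsWithin] with L hL
  have hL0 : 0 < L := hL
  have hLp : 0 < L ^ p := by positivity
  have h := le_Mplus (p := p) (f := f) (z := z) (x := z.1) (t := z.2 + L ^ p / 2) hL0
    ⟨fun i => by rw [sub_self, abs_zero]; positivity, by constructor <;> linarith⟩
  rw [setAverage_congr (pPlus_ae_eq_parBox _ _ _)] at h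
  rw [show z.2 + L ^ p / 2 + L ^ p / 2 = z.2 + 1 * L ^ p by ring] at h
  simpa only [Function.comp_apply, abs_of_nonneg (hf0 _)] using h

end MaximalFunction

section WeakType

variable {n : ℕ} {p : ℝ}

/-- A stopping-time selection of the scale. -/
lemma exists_stopping_scale {f : (Fin n → ℝ) × ℝ → ℝ} {z : (Fin n → ℝ) × ℝ} {L c : ℝ}
    (hL : 0 < L) (h0 : ⨍ y in parBox n p z.1 z.2 L, f y ≤ c) (hc : c < f z)
    (hz : Tendsto (fun r : ℝ => ⨍ y in parBox n p z.1 z.2 r, f y) (𝓝[>] 0) (𝓝 (f z))) :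
    ∃ l, 0 < l ∧ 12 * l ≤ L ∧ c < ⨍ y in parBox n p z.1 z.2 l, f y ∧
      ⨍ y in parBox n p z.1 z.2 (12 * l), f y ≤ c := by
  classical
  have hlim : Tendsto (fun k : ℕ => L * (1 / 12 : ℝ) ^ k) atTop (𝓝[>] 0) := by
    refine tendsto_nhdsWithin_iff.2 ⟨?_, Eventually.of_forall fun k => ?_⟩
    · simpa using (tendsto_pow_atTop_nhds_zero_of_lt_one (r := (1 / 12 : ℝ)) (by norm_num)
        (by norm_num)).const_mul L
    · exact mem_Ioi.2 (by positivity)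
  have hex : ∃ k : ℕ, c < ⨍ y in parBox n p z.1 z.2 (L * (1 / 12 : ℝ) ^ k), f y :=
    ((hz.comp hlim).eventually (lt_mem_nhds hc)).exists
  obtain ⟨k, hk⟩ : ∃ k, Nat.find hex = k + 1 := by
    refine Nat.exists_eq_succ_of_ne_zero fun h => ?_
    have := Nat.find_spec hex
    rw [h, pow_zero, mul_one] at this
    exact this.not_ge h0
  refine ⟨L * (1 / 12 : ℝ) ^ (k + 1), by positivity, ?_, hk ▸ Nat.find_spec hex, ?_⟩
  · have : (1 / 12 : ℝ) ^ k ≤ 1 := pow_le_one₀ (by norm_num) (by norm_num)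
    rw [pow_succ]
    nlinarith
  · have h := Nat.find_min hex (m := k) (by omega)
    rw [not_lt] at h
    rwa [show 12 * (L * (1 / 12 : ℝ) ^ (k + 1)) = L * (1 / 12 : ℝ) ^ k by ring]

/-- Points of intersecting selected boxes are close at a comparable scale. -/
lemma mem_parBox_of_inter_nonempty (hp : 1 < p) {a b : (Fin n → ℝ) × ℝ} {xa xb : Fin n → ℝ}
    {la lb : ℝ} (hla : 0 < la) (hlb : 0 < lb) (hab : la ≤ 2 * lb)
    (ha : a.1 ∈ parQ n xa la) (hb : b.1 ∈ parQ n xb lb)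
    (h : ((parQ n xa la ×ˢ Icc (a.2 - 3 / 2 * la ^ p) (a.2 + la ^ p / 2)) ∩
      (parQ n xb lb ×ˢ Icc (b.2 - 3 / 2 * lb ^ p) (b.2 + lb ^ p / 2))).Nonempty) :
    a ∈ parBox n p b.1 b.2 (12 * lb) := by
  obtain ⟨y, ⟨hya, hya'⟩, ⟨hyb, hyb'⟩⟩ := h
  have hp0 : 0 ≤ p := by linarith
  refine ⟨fun i => ?_, ?_⟩
  · have h1 := abs_le.1 (ha i)
    have h2 := abs_le.1 (hb i)
    have h3 := abs_le.1 (hya i)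
    have h4 := abs_le.1 (hyb i)
    rw [abs_le]
    constructor <;> linarith
  · have h1 : la ^ p ≤ 2 ^ p * lb ^ p := by
      rw [← Real.mul_rpow two_pos.le hlb.le]
      exact Real.rpow_le_rpow hla.le hab hp0
    have h2 : (12 * lb) ^ p = 6 ^ p * (2 ^ p * lb ^ p) := by
      rw [← Real.mul_rpow two_pos.le hlb.le, ← Real.mul_rpow (by norm_num) (by positivity)]
      ring_nf
    have h3 : (6 : ℝ) ≤ 6 ^ p := by
      simpa using Real.rpow_le_rpow_of_exponent_le (x := 6) (by norm_num) hp.le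
    have h4 : lb ^ p ≤ 2 ^ p * lb ^ p :=
      le_mul_of_one_le_left (by positivity) (Real.one_le_rpow one_le_two hp0)
    have h5 : 6 * (2 ^ p * lb ^ p) ≤ (12 * lb) ^ p := by
      rw [h2]
      gcongr
    obtain ⟨h6, h7⟩ := hya'
    obtain ⟨h8, h9⟩ := hyb'
    constructor <;> linarith

/-- If the average of `f` over a box exceeds `c`, then the maximal function exceeds `c` on the
interior of the box preceding the nearby subbox of the supporting rectangle. -/
lemma lt_MplusInterior {f : (Fin n → ℝ) × ℝ → ℝ} (hf0 : ∀ z, 0 ≤ f z) (hfi : Integrable f)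
    {x x' : Fin n → ℝ} {t L l c : ℝ} (hl : 0 < l) (hc : 0 ≤ c)
    (hf : Function.support f ⊆ pMinus n p 0 x t L)
    {z y : (Fin n → ℝ) × ℝ} (hx' : parQ n z.1 l ∩ parQ n x L ⊆ parQ n x' l)
    (hz : c < ⨍ y in parBox n p z.1 z.2 l, f y)
    (hy : y ∈ ball x' (l / 2) ×ˢ Ioo (z.2 - 3 / 2 * l ^ p) (z.2 - l ^ p / 2)) :
    ENNReal.ofReal c < MplusInterior n p f y := by
  have hlp : 0 < l ^ p := by positivity
  refine lt_of_lt_of_le ?_ (le_MplusInterior (x := x') (t := z.2 - l ^ p / 2) hl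
    ⟨hy.1, ?_⟩)
  · have hle : ⨍ y in parBox n p z.1 z.2 l, f y ≤ ⨍ y in parBox n p x' z.2 l, f y := by
      rw [setAverage_parBox f _ _ hl, setAverage_parBox f _ _ hl]
      gcongr ?_ / _
      rw [← integral_indicator (measurableSet_parBox _ _ _),
        ← integral_indicator (measurableSet_parBox _ _ _)]
      refine integral_mono (hfi.indicator (measurableSet_parBox _ _ _))
        (hfi.indicator (measurableSet_parBox _ _ _)) fun u => ?_
      by_cases hu : u ∈ parBox n p z.1 z.2 l
      · rw [indicator_of_mem hu]
        by_cases hu' : f u = 0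
        · rw [hu']
          exact indicator_nonneg (fun _ _ => hf0 _) _
        · rw [indicator_of_mem (show u ∈ parBox n p x' z.2 l from
            ⟨hx' ⟨hu.1, (hf hu').1⟩, hu.2⟩)]
      · rw [indicator_of_notMem hu]
        exact indicator_nonneg (fun _ _ => hf0 _) _
    simp only [abs_of_nonneg (hf0 _)]
    rw [setAverage_congr (pPlus_ae_eq_parBox _ _ _), sub_add_cancel]
    exact (ENNReal.ofReal_lt_ofReal_iff (hc.trans_lt (hz.trans_le hle))).2 (hz.trans_le hle)
  · constructor <;> linarith [hy.2.1, hy.2.2]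

/-- The reverse weak-type inequality for the forward-in-time maximal function. -/
lemma setLIntegral_le_volume_MplusInterior (hp : 1 < p) {f : (Fin n → ℝ) × ℝ → ℝ}
    (hf0 : ∀ z, 0 ≤ f z) (hfi : Integrable f) {x : Fin n → ℝ} {t L c : ℝ} (hL : 0 < L)
    (hf : Function.support f ⊆ pMinus n p 0 x t L) (hc : 0 < c)
    (hfc : ∫ z, f z ≤ c * (L ^ n * L ^ p)) :
    ∫⁻ z in {z | c < f z} ∩ {z ∈ pMinus n p 0 x t L | t - L ^ p / 2 < z.2},
        ENNReal.ofReal (f z) ≤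
      ENNReal.ofReal (c * (12 ^ n * 12 ^ p)) *
        volume ({z | ENNReal.ofReal c < MplusInterior n p f z} ∩ pMinus n p 0 x t L) := by
  have hp0 : 0 < p := one_pos.trans hp
  set R := pMinus n p 0 x t L with hR
  set G : Set ((Fin n → ℝ) × ℝ) := {z | Tendsto
    (fun r : ℝ => ⨍ y in parBox n p z.1 z.2 r, f y) (𝓝[>] 0) (𝓝 (f z))} with hG
  have hGae : ∀ᵐ z, z ∈ G := by
    filter_upwards [ae_tendsto_average_parBox hp hfi.locallyIntegrable le_rfl] with z hz
    simpa [hG] using hz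
  set A : Set ((Fin n → ℝ) × ℝ) := ({z | c < f z} ∩ {z ∈ R | t - L ^ p / 2 < z.2}) ∩ G with hA
  have havg : ∀ z : (Fin n → ℝ) × ℝ, ⨍ y in parBox n p z.1 z.2 L, f y ≤ c := fun z => by
    rw [setAverage_parBox f _ _ hL, div_le_iff₀ (by positivity)]
    exact (setIntegral_le_integral hfi (Eventually.of_forall hf0)).trans hfc
  have hsel : ∀ z : A, ∃ l, 0 < l ∧ 12 * l ≤ L ∧ c < ⨍ y in parBox n p z.1.1 z.1.2 l, f y ∧
      ⨍ y in parBox n p z.1.1 z.1.2 (12 * l), f y ≤ c :=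
    fun z => exists_stopping_scale hL (havg z) z.2.1.1 z.2.2
  choose l hl hlL hlc hlc' using hsel
  have hsel' : ∀ z : A, ∃ y', z.1.1 ∈ parQ n y' (l z) ∧ parQ n y' (l z) ⊆ parQ n x L ∧
      parQ n z.1.1 (l z) ∩ parQ n x L ⊆ parQ n y' (l z) := fun z =>
    exists_parQ_subset (hl z).le (by linarith [hl z, hlL z]) z.2.1.2.1.1
  choose y hy1 hy2 hy3 using hsel'
  let B : A → Set ((Fin n → ℝ) × ℝ) := fun z =>
    parQ n (y z) (l z) ×ˢ Icc (z.1.2 - 3 / 2 * l z ^ p) (z.1.2 + l z ^ p / 2)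
  let D : A → Set ((Fin n → ℝ) × ℝ) := fun z =>
    ball (y z) (l z / 2) ×ˢ Ioo (z.1.2 - 3 / 2 * l z ^ p) (z.1.2 - l z ^ p / 2)
  have hlp : ∀ z, 0 < l z ^ p := fun z => Real.rpow_pos_of_pos (hl z) p
  have hDB : ∀ z, D z ⊆ B z := fun z => by
    refine prod_mono ?_ fun s hs => ⟨hs.1.le, by linarith [hs.2, hlp z]⟩
    rw [parQ_eq_closedBall _ (hl z).le]
    exact ball_subset_closedBall
  have hDopen : ∀ z, IsOpen (D z) := fun z => isOpen_ball.prod isOpen_Ioo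
  have hDne : ∀ z, (D z).Nonempty := fun z =>
    (nonempty_ball.2 (half_pos (hl z))).prod (nonempty_Ioo.2 (by linarith [hlp z]))
  have hDvol : ∀ z, volume (D z) = ENNReal.ofReal (l z ^ n * l z ^ p) := fun z => by
    rw [Measure.volume_eq_prod, Measure.prod_prod, Real.volume_pi_ball _ (half_pos (hl z)),
      Real.volume_Ioo, Fintype.card_fin, ENNReal.ofReal_mul (pow_nonneg (hl z).le n)]
    ring_nf
  have hDR : ∀ z, D z ⊆ {z | ENNReal.ofReal c < MplusInterior n p f z} ∩ R := fun z u hu => by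
    refine ⟨lt_MplusInterior hf0 hfi (hl z) hc.le hf (hy3 z) (hlc z) hu, hy2 z (hDB z hu).1, ?_⟩
    have h1 : (12 * l z) ^ p ≤ L ^ p :=
      Real.rpow_le_rpow (by linarith [hl z]) (hlL z) hp0.le
    rw [Real.mul_rpow (by norm_num) (hl z).le] at h1
    have h2 : (12 : ℝ) ≤ 12 ^ p := by
      simpa using Real.rpow_le_rpow_of_exponent_le (x := 12) (by norm_num) hp.le
    have h3 : 12 * l z ^ p ≤ 12 ^ p * l z ^ p := by gcongr; exact (hlp z).le
    have h4 : t - L ^ p / 2 < z.1.2 := z.2.1.2.2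
    have h5 : z.1.2 < t - 0 * L ^ p := z.2.1.2.1.2.2
    have h6 := hu.2.1
    have h7 := hu.2.2
    have h8 := hlp z
    constructor <;> linarith
  obtain ⟨u, -, hdisj, hcov⟩ := Vitali.exists_disjoint_subfamily_covering_enlargement B univ l 2
    one_lt_two (fun z _ => (hl z).le) L (fun z _ => by linarith [hl z, hlL z])
    (fun z _ => (hDne z).mono (hDB z))
  have hDdisj : u.PairwiseDisjoint D := hdisj.mono_on fun z _ => hDB z
  have hucount : u.Countable := hDdisj.countable_of_isOpen (fun z _ => hDopen z) fun z _ => hDne z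
  have := hucount.to_subtype
  have hAcov : A ⊆ ⋃ b : u, parBox n p b.1.1.1 b.1.1.2 (12 * l b) := fun z hz => by
    obtain ⟨b, hbu, hne, hle⟩ := hcov ⟨z, hz⟩ (mem_univ _)
    exact mem_iUnion.2 ⟨⟨b, hbu⟩, mem_parBox_of_inter_nonempty hp (hl _) (hl b) hle (hy1 _)
      (hy1 b) hne⟩
  have hbox : ∀ b : u, ∫⁻ z in parBox n p b.1.1.1 b.1.1.2 (12 * l b), ENNReal.ofReal (f z) ≤
      ENNReal.ofReal (c * (12 ^ n * 12 ^ p)) * volume (D b) := fun b => by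
    rw [hDvol, ← ENNReal.ofReal_mul (by positivity),
      ← ofReal_integral_eq_lintegral_ofReal hfi.integrableOn (Eventually.of_forall hf0)]
    apply ENNReal.ofReal_le_ofReal
    have hlb := hl b
    have h := hlc' b
    rw [setAverage_parBox f _ _ (by positivity), div_le_iff₀ (by positivity), mul_pow,
      Real.mul_rpow (by norm_num) hlb.le] at h
    linarith
  calc ∫⁻ z in {z | c < f z} ∩ {z ∈ R | t - L ^ p / 2 < z.2}, ENNReal.ofReal (f z)
      = ∫⁻ z in A, ENNReal.ofReal (f z) := by
        refine setLIntegral_congr ?_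
        filter_upwards [hGae] with z hz
        exact propext ⟨fun h => ⟨h, hz⟩, fun h => h.1⟩
    _ ≤ ∫⁻ z in ⋃ b : u, parBox n p b.1.1.1 b.1.1.2 (12 * l b), ENNReal.ofReal (f z) :=
        lintegral_mono_set hAcov
    _ ≤ ∑' b : u, ∫⁻ z in parBox n p b.1.1.1 b.1.1.2 (12 * l b), ENNReal.ofReal (f z) :=
        lintegral_iUnion_le _ _
    _ ≤ ∑' b : u, ENNReal.ofReal (c * (12 ^ n * 12 ^ p)) * volume (D b) :=
        ENNReal.tsum_le_tsum hbox
    _ = ENNReal.ofReal (c * (12 ^ n * 12 ^ p)) * volume (⋃ b : u, D b) := by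
        rw [ENNReal.tsum_mul_left, measure_iUnion (hDdisj.subtype _ _)
          fun b => (hDopen b).measurableSet]
    _ ≤ _ := by
        gcongr
        exact iUnion_subset fun b => hDR b

end WeakType

section LayerCake

variable {n : ℕ} {p : ℝ}

lemma lintegral_measure_ofReal_lt_le {α : Type*} [MeasurableSpace α] (μ : Measure α)
    {h : α → ℝ≥0∞} (hh : AEMeasurable h μ) :
    ∫⁻ c in Ioi (0 : ℝ), μ {z | ENNReal.ofReal c < h z} ≤ ∫⁻ z, h z ∂μ := by
  by_cases htop : ∫⁻ z, h z ∂μ = ∞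
  · simp [htop]
  have hfin : ∀ᵐ z ∂μ, h z < ∞ := ae_lt_top' hh htop
  calc ∫⁻ c in Ioi (0 : ℝ), μ {z | ENNReal.ofReal c < h z}
      ≤ ∫⁻ c in Ioi (0 : ℝ), μ {z | c < (h z).toReal} := by
        refine lintegral_mono fun c => measure_mono_ae ?_
        filter_upwards [hfin] with z hz hcz
        refine lt_of_not_ge fun hle => (show ENNReal.ofReal c < h z from hcz).not_ge ?_
        rw [← ENNReal.ofReal_toReal hz.ne]
        exact ENNReal.ofReal_le_ofReal hle
    _ = ∫⁻ z, ENNReal.ofReal (h z).toReal ∂μ :=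
        (lintegral_eq_lintegral_meas_lt μ (Eventually.of_forall fun _ => toReal_nonneg)
          hh.ennreal_toReal).symm
    _ ≤ ∫⁻ z, h z ∂μ := lintegral_mono fun z => ofReal_toReal_le

lemma intervalIntegrable_indicator_inv {c : ℝ} (hc : 0 < c) (a b : ℝ) :
    IntervalIntegrable ((Ioi c).indicator fun s => s⁻¹) volume a b := by
  have hcont : Continuous fun s : ℝ => (max s c)⁻¹ :=
    (continuous_id.max continuous_const).inv₀ fun s => (lt_max_of_lt_right hc).ne'
  have heq : ((Ioi c).indicator fun s => s⁻¹) = (Ioi c).indicator fun s : ℝ => (max s c)⁻¹ :=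
    indicator_congr fun s hs => by rw [max_eq_left (le_of_lt hs)]
  rw [heq]
  exact ⟨(hcont.intervalIntegrable a b).1.indicator measurableSet_Ioi,
    (hcont.intervalIntegrable a b).2.indicator measurableSet_Ioi⟩

lemma max_log_div_le_integral {c s : ℝ} (hc : 0 < c) (hs : 0 ≤ s) :
    max (Real.log (s / c)) 0 ≤ ∫ r in 0..s, (Ioi c).indicator (fun r => r⁻¹) r := by
  have hnn : ∀ r, 0 ≤ (Ioi c).indicator (fun r : ℝ => r⁻¹) r := fun r =>
    indicator_nonneg (fun r hr => inv_nonneg.2 (hc.trans hr).le) r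
  refine max_le ?_ (intervalIntegral.integral_nonneg_of_forall hs hnn)
  rcases le_total s c with h | h
  · exact (Real.log_nonpos (by positivity) (div_le_one_of_le₀ h hc.le)).trans
      (intervalIntegral.integral_nonneg_of_forall hs hnn)
  · calc Real.log (s / c) = ∫ r in c..s, r⁻¹ := (integral_inv_of_pos hc (hc.trans_le h)).symm
      _ = ∫ r in c..s, (Ioi c).indicator (fun r => r⁻¹) r := by
          rw [intervalIntegral.integral_of_le h, intervalIntegral.integral_of_le h]
          refine setIntegral_congr_fun measurableSet_Ioc fun r hr => ?_
          exact (indicator_of_mem (show r ∈ Ioi c from hr.1) _).symm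
      _ ≤ _ := intervalIntegral.integral_mono_interval hc.le h le_rfl
          (Eventually.of_forall hnn) (intervalIntegrable_indicator_inv hc 0 s)

/-- The logarithmic bound on the upper half of the lower part of a rectangle. -/
lemma setLIntegral_mul_log_le (hp : 1 < p) {f : (Fin n → ℝ) × ℝ → ℝ}
    (hf0 : ∀ z, 0 ≤ f z) (hfi : Integrable f) {x : Fin n → ℝ} {t L c : ℝ} (hL : 0 < L)
    (hf : Function.support f ⊆ pMinus n p 0 x t L) (hc : 0 < c)
    (hfc : ∫ z, f z ≤ c * (L ^ n * L ^ p)) :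
    ∫⁻ z in {z ∈ pMinus n p 0 x t L | t - L ^ p / 2 < z.2},
        ENNReal.ofReal (f z * max (Real.log (f z / c)) 0) ≤
      ENNReal.ofReal (12 ^ n * 12 ^ p) * ∫⁻ z in pMinus n p 0 x t L, MplusInterior n p f z := by
  set R := pMinus n p 0 x t L with hR
  set E := {z ∈ R | t - L ^ p / 2 < z.2} with hE
  have hRm : MeasurableSet R := measurableSet_pMinus _ _ _
  have hEm : MeasurableSet E := hRm.inter (measurableSet_lt measurable_const measurable_snd)
  set μ : Measure ((Fin n → ℝ) × ℝ) :=
    (volume.restrict E).withDensity fun z => ENNReal.ofReal (f z) with hμ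
  have hfm : AEMeasurable f (volume.restrict E) := hfi.aemeasurable.restrict
  have hμac : μ ≪ volume.restrict E := withDensity_absolutelyContinuous _ _
  have hlog : AEMeasurable (fun z => ENNReal.ofReal (max (Real.log (f z / c)) 0))
      (volume.restrict E) := by fun_prop
  have hg0 : ∀ r, 0 ≤ (Ioi c).indicator (fun r : ℝ => r⁻¹) r := fun r =>
    indicator_nonneg (fun r hr => inv_nonneg.2 (hc.trans hr).le) r
  calc ∫⁻ z in E, ENNReal.ofReal (f z * max (Real.log (f z / c)) 0)
      = ∫⁻ z, ENNReal.ofReal (max (Real.log (f z / c)) 0) ∂μ := by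
        rw [hμ, lintegral_withDensity_eq_lintegral_mul₀ hfm.ennreal_ofReal hlog]
        simp only [Pi.mul_apply, ENNReal.ofReal_mul (hf0 _)]
    _ ≤ ∫⁻ z, ENNReal.ofReal (∫ r in 0..f z, (Ioi c).indicator (fun r => r⁻¹) r) ∂μ :=
        lintegral_mono fun z => ENNReal.ofReal_le_ofReal (max_log_div_le_integral hc (hf0 z))
    _ = ∫⁻ s in Ioi 0, μ {z | s < f z} *
          ENNReal.ofReal ((Ioi c).indicator (fun r => r⁻¹) s) :=
        lintegral_comp_eq_lintegral_meas_lt_mul μ (Eventually.of_forall hf0)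
          (hfm.mono_ac hμac) (fun _ _ => intervalIntegrable_indicator_inv hc _ _)
          (Eventually.of_forall hg0)
    _ ≤ ∫⁻ s in Ioi 0, ENNReal.ofReal (12 ^ n * 12 ^ p) *
          (volume.restrict R) {z | ENNReal.ofReal s < MplusInterior n p f z} := by
        refine lintegral_mono fun s => ?_
        by_cases hs : c < s
        · have hs0 : 0 < s := hc.trans hs
          have hweak := setLIntegral_le_volume_MplusInterior hp hf0 hfi hL hf hs0
            (hfc.trans (by gcongr))
          rw [hμ, withDensity_apply', Measure.restrict_restrict' hEm,
            Measure.restrict_apply' hRm, indicator_of_mem (mem_Ioi.2 hs)]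
          refine (mul_le_mul_left hweak _).trans (le_of_eq ?_)
          rw [mul_right_comm, ← ENNReal.ofReal_mul (by positivity)]
          congr 2
          field_simp
        · rw [indicator_of_notMem (by simpa using hs), ENNReal.ofReal_zero, mul_zero]
          exact zero_le
    _ = ENNReal.ofReal (12 ^ n * 12 ^ p) * ∫⁻ s in Ioi (0 : ℝ),
          (volume.restrict R) {z | ENNReal.ofReal s < MplusInterior n p f z} :=
        lintegral_const_mul' _ _ ENNReal.ofReal_ne_top
    _ ≤ _ := by
        gcongr
        exact lintegral_measure_ofReal_lt_le _ (measurable_MplusInterior f).aemeasurable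

lemma mul_max_log_div_le {s a K : ℝ} (hs : 0 ≤ s) (ha : 0 < a) (hK : 1 ≤ K) :
    s * max (Real.log (s / a)) 0 ≤ s * max (Real.log (s / (K * a))) 0 + Real.log K * s := by
  rcases hs.eq_or_lt with rfl | hs
  · simp
  have hK0 : 0 < K := one_pos.trans_le hK
  have h1 : Real.log (s / a) = Real.log (s / (K * a)) + Real.log K := by
    rw [← Real.log_mul (by positivity) hK0.ne']
    congr 1
    field_simp
  have h2 : 0 ≤ Real.log K := Real.log_nonneg hK
  rw [h1, mul_comm (Real.log K), ← mul_add]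
  gcongr
  refine max_le ?_ ?_
  · gcongr
    exact le_max_left _ _
  · positivity

end LayerCake

section ForwardDoubling

variable {n : ℕ} {p : ℝ} {w : (Fin n → ℝ) × ℝ → ℝ} {C : ℝ}

lemma pMinus_integrableOn (hw : LocallyIntegrable w) (x : Fin n → ℝ) (t : ℝ) {L : ℝ}
    (hL : 0 ≤ L) : IntegrableOn w (pMinus n p 0 x t L) := by
  rw [pMinus_eq_pPlus]
  exact pPlus_integrableOn hw x _ hL

/-- The Fujii–Wilson condition at `(x, t, L)`, with right-hand side a Bochner integral. -/
lemma lintegral_Mplus_le (hw : IsWeight n w) (hC : 0 ≤ C) {x : Fin n → ℝ} {t L : ℝ} (hL : 0 ≤ L)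
    (H : (∫⁻ z in pMinus n p 0 x t L, Mplus n p ((pMinus n p 0 x t L).indicator w) z) ≤
        ENNReal.ofReal C * ∫⁻ z in pPlus n p 0 x t L, ENNReal.ofReal (w z)) :
    (∫⁻ z in pMinus n p 0 x t L, Mplus n p ((pMinus n p 0 x t L).indicator w) z) ≤
      ENNReal.ofReal (C * ∫ z in pPlus n p 0 x t L, w z) := by
  rwa [ENNReal.ofReal_mul hC, ofReal_integral_eq_lintegral_ofReal
    (pPlus_integrableOn hw.2 x t hL) (Eventually.of_forall hw.1)]

lemma integrable_indicator_pMinus (hw : IsWeight n w) (x : Fin n → ℝ) (t : ℝ) {L : ℝ}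
    (hL : 0 ≤ L) : Integrable ((pMinus n p 0 x t L).indicator w) :=
  (integrable_indicator_iff (measurableSet_pMinus _ _ _)).2 (pMinus_integrableOn hw.2 x t hL)

/-- The Fujii–Wilson condition implies forward-in-time doubling. -/
lemma setIntegral_pMinus_le (hp : 1 < p) (hw : IsWeight n w) (hC : 0 ≤ C) {x : Fin n → ℝ}
    {t L : ℝ} (hL : 0 < L)
    (H : (∫⁻ z in pMinus n p 0 x t L, Mplus n p ((pMinus n p 0 x t L).indicator w) z) ≤
        ENNReal.ofReal C * ∫⁻ z in pPlus n p 0 x t L, ENNReal.ofReal (w z)) :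
    ∫ z in pMinus n p 0 x t L, w z ≤ C * ∫ z in pPlus n p 0 x t L, w z := by
  have hnn : 0 ≤ C * ∫ z in pPlus n p 0 x t L, w z :=
    mul_nonneg hC (integral_nonneg hw.1)
  rw [← ENNReal.ofReal_le_ofReal_iff hnn, ofReal_integral_eq_lintegral_ofReal
    (pMinus_integrableOn hw.2 x t hL.le) (Eventually.of_forall hw.1)]
  refine le_trans ?_ (lintegral_Mplus_le hw hC hL.le H)
  refine lintegral_mono_ae ?_
  filter_upwards [ae_restrict_of_ae (ae_le_Mplus hp (fun z => indicator_nonneg (fun _ _ => hw.1 _) z)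
    (integrable_indicator_pMinus (p := p) hw x t hL.le).locallyIntegrable),
    ae_restrict_mem (measurableSet_pMinus x t L)] with z hz hzR
  rwa [indicator_of_mem hzR] at hz

/-- The logarithmic bound on the upper half of the lower part of a rectangle for weights satisfying
the Fujii–Wilson condition. -/
lemma setLIntegral_upperHalf_le (hp : 1 < p) (hw : IsWeight n w) (hC : 0 ≤ C) {x : Fin n → ℝ}
    {t L c : ℝ} (hL : 0 < L) (hc : 0 < c)
    (H : (∫⁻ z in pMinus n p 0 x t L, Mplus n p ((pMinus n p 0 x t L).indicator w) z) ≤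
        ENNReal.ofReal C * ∫⁻ z in pPlus n p 0 x t L, ENNReal.ofReal (w z))
    (hwc : ∫ z in pMinus n p 0 x t L, w z ≤ c * (L ^ n * L ^ p)) :
    ∫⁻ z in {z ∈ pMinus n p 0 x t L | t - L ^ p / 2 < z.2},
        ENNReal.ofReal (w z * max (Real.log (w z / c)) 0) ≤
      ENNReal.ofReal (12 ^ n * 12 ^ p * (C * ∫ z in pPlus n p 0 x t L, w z)) := by
  set R := pMinus n p 0 x t L with hR
  have hRm : MeasurableSet R := measurableSet_pMinus _ _ _
  have h := setLIntegral_mul_log_le hp (fun z => indicator_nonneg (fun _ _ => hw.1 _) z)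
    (integrable_indicator_pMinus (p := p) hw x t hL.le) hL support_indicator_subset hc
    (by rwa [integral_indicator hRm])
  rw [ENNReal.ofReal_mul (by positivity)]
  refine le_trans (le_of_eq ?_) (h.trans ?_)
  · refine setLIntegral_congr_fun
      (hRm.inter (measurableSet_lt measurable_const measurable_snd)) fun z hz => ?_
    have hzR : z ∈ pMinus n p 0 x t L := hz.1
    simp only [indicator_of_mem hzR]
  · gcongr
    exact (lintegral_mono fun z => MplusInterior_le_Mplus _ z).trans
      (lintegral_Mplus_le hw hC hL.le H)

end ForwardDoubling

lemma pMinus_eq_prod {n : ℕ} {p : ℝ} (x : Fin n → ℝ) (t L : ℝ) :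
    pMinus n p 0 x t L = parQ n x L ×ˢ Ioo (t - L ^ p) t := by
  simp [pMinus]

lemma pPlus_eq_prod {n : ℕ} {p : ℝ} (x : Fin n → ℝ) (t L : ℝ) :
    pPlus n p 0 x t L = parQ n x L ×ˢ Ioo t (t + L ^ p) := by
  simp [pPlus]

lemma prod_Ioo_ae_subset_union {n : ℕ} (A : Set (Fin n → ℝ)) (a b c : ℝ) :
    A ×ˢ Ioo a c ≤ᵐ[volume] (A ×ˢ Ioo a b ∪ A ×ˢ Ioo b c : Set ((Fin n → ℝ) × ℝ)) := by
  have h : A ×ˢ Ioo a c ⊆ (A ×ˢ Ioo a b ∪ A ×ˢ Ico b c : Set ((Fin n → ℝ) × ℝ)) := by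
    rintro z ⟨h1, h2, h3⟩
    rcases lt_or_ge z.2 b with h | h
    · exact Or.inl ⟨h1, h2, h⟩
    · exact Or.inr ⟨h1, h, h3⟩
  exact (LE.le.eventuallyLE h).trans
    ((ae_eq_refl (A ×ˢ Ioo a b)).union (prod_ae_eq_prod A (Ico_ae_eq_Icc.trans Ioo_ae_eq_Icc.symm))).le

/-- The parabolic Fujii–Wilson condition implies the parabolic logarithmic condition. -/
theorem stmt_14 (n : ℕ) (p : ℝ) (hp : 1 < p)
    (w : (Fin n → ℝ) × ℝ → ℝ) (hw : IsWeight n w)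
    (C₁ : ℝ) (hC₁ : 0 < C₁)
    (H : ∀ (x : Fin n → ℝ) (t L : ℝ), 0 < L →
      (∫⁻ z in pMinus n p 0 x t L, Mplus n p ((pMinus n p 0 x t L).indicator w) z) ≤
        ENNReal.ofReal C₁ * ∫⁻ z in pPlus n p 0 x t L, ENNReal.ofReal (w z)) :
    ∃ C₂ > (0 : ℝ), ∀ (x : Fin n → ℝ) (t L : ℝ), 0 < L →
      (∫ z in pMinus n p 0 x t L,
          w z * max (Real.log (w z / (⨍ y in pPlus n p 0 x t L, w y))) 0) ≤
        C₂ * ∫ z in pPlus n p 0 x t L, w z := by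

  set K : ℝ := 1 + C₁ * (1 + C₁) with hK
  set M : ℝ := 12 ^ n * 12 ^ p with hM
  have hK1 : 1 ≤ K := by
    have : 0 ≤ C₁ * (1 + C₁) := by positivity
    linarith
  have hlogK : 0 ≤ Real.log K := Real.log_nonneg hK1
  refine ⟨M * C₁ + M * (C₁ * (1 + C₁)) + Real.log K * C₁, by positivity, fun x t L hL => ?_⟩
  set V : ℝ := L ^ n * L ^ p with hV
  have hV0 : 0 < V := by positivity
  have hLp : 0 < L ^ p := by positivity
  set W : ℝ := ∫ z in pPlus n p 0 x t L, w z with hW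
  have hW0 : 0 ≤ W := integral_nonneg hw.1
  have ha : ⨍ y in pPlus n p 0 x t L, w y = W / V := setAverage_pPlus w x t hL
  rw [ha]
  rcases hW0.eq_or_lt with hW0' | hWpos
  · simp [← hW0']
  have hapos : 0 < W / V := by positivity
  have hKa : 0 < K * (W / V) := by positivity
  have hminus := setIntegral_pMinus_le hp hw hC₁.le hL (H x t L hL)
  have hminus' := setIntegral_pMinus_le hp hw hC₁.le hL (H x (t - L ^ p / 2) L hL)
  have hplus' : ∫ z in pPlus n p 0 x (t - L ^ p / 2) L, w z ≤ (1 + C₁) * W := by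
    calc ∫ z in pPlus n p 0 x (t - L ^ p / 2) L, w z
        ≤ ∫ z in pMinus n p 0 x t L ∪ pPlus n p 0 x t L, w z := by
          refine setIntegral_mono_set ((pMinus_integrableOn hw.2 x t hL.le).union
            (pPlus_integrableOn hw.2 x t hL.le)) (Eventually.of_forall hw.1) ?_
          rw [pPlus_eq_prod, pPlus_eq_prod, pMinus_eq_prod]
          refine (prod_Ioo_ae_subset_union _ _ t _).trans (LE.le.eventuallyLE ?_)
          gcongr <;> linarith
      _ = (∫ z in pMinus n p 0 x t L, w z) + W := by
          refine setIntegral_union ?_ (measurableSet_pPlus _ _ _)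
            (pMinus_integrableOn hw.2 x t hL.le) (pPlus_integrableOn hw.2 x t hL.le)
          rw [pPlus_eq_prod, pMinus_eq_prod, disjoint_left]
          exact fun z hz hz' => hz.2.2.not_gt hz'.2.1
      _ ≤ (1 + C₁) * W := by linarith
  have hminus'' : ∫ z in pMinus n p 0 x (t - L ^ p / 2) L, w z ≤ C₁ * (1 + C₁) * W := by
    rw [mul_assoc]
    exact hminus'.trans (by gcongr)
  have hcancel : K * (W / V) * (L ^ n * L ^ p) = K * W := by
    rw [← hV]
    field_simp
  have hKW : C₁ * (1 + C₁) * W ≤ K * W := by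
    gcongr
    linarith
  have hC₁W : C₁ * W ≤ C₁ * (1 + C₁) * W := by
    gcongr
    nlinarith
  have hup := setLIntegral_upperHalf_le hp hw hC₁.le hL hKa (H x t L hL)
    (by rw [hcancel]; linarith)
  have hlow := setLIntegral_upperHalf_le hp hw hC₁.le hL hKa (H x (t - L ^ p / 2) L hL)
    (by rw [hcancel]; linarith)
  set E₁ := {z ∈ pMinus n p 0 x t L | t - L ^ p / 2 < z.2} with hE₁
  set E₂ := {z ∈ pMinus n p 0 x (t - L ^ p / 2) L | t - L ^ p / 2 - L ^ p / 2 < z.2} with hE₂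
  have hcover : pMinus n p 0 x t L ≤ᵐ[volume] (E₂ ∪ E₁ : Set ((Fin n → ℝ) × ℝ)) := by
    have h := prod_Ioo_ae_subset_union (parQ n x L) (t - L ^ p) (t - L ^ p / 2) t
    rw [pMinus_eq_prod]
    refine h.trans (LE.le.eventuallyLE (union_subset_union ?_ ?_))
    · rw [hE₂, pMinus_eq_prod]
      rintro z ⟨h1, h2, h3⟩
      exact ⟨⟨h1, by linarith, h3⟩, by linarith⟩
    · rw [hE₁, pMinus_eq_prod]
      rintro z ⟨h1, h2, h3⟩
      exact ⟨⟨h1, by linarith, h3⟩, h2⟩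
  have hwm : AEMeasurable w (volume.restrict (pMinus n p 0 x t L)) :=
    (pMinus_integrableOn hw.2 x t hL.le).aemeasurable
  rw [integral_eq_lintegral_of_nonneg_ae
    (Eventually.of_forall fun z => mul_nonneg (hw.1 z) (le_max_right _ _))
    (by fun_prop)]
  refine ENNReal.toReal_le_of_le_ofReal (by positivity) ?_
  calc ∫⁻ z in pMinus n p 0 x t L, ENNReal.ofReal (w z * max (Real.log (w z / (W / V))) 0)
      ≤ ∫⁻ z in pMinus n p 0 x t L,
          (ENNReal.ofReal (w z * max (Real.log (w z / (K * (W / V)))) 0) +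
            ENNReal.ofReal (Real.log K) * ENNReal.ofReal (w z)) := by
        refine lintegral_mono fun z => ?_
        rw [← ENNReal.ofReal_mul hlogK, ← ENNReal.ofReal_add
          (mul_nonneg (hw.1 z) (le_max_right _ _)) (mul_nonneg hlogK (hw.1 z))]
        exact ENNReal.ofReal_le_ofReal (mul_max_log_div_le (hw.1 z) hapos hK1)
    _ = (∫⁻ z in pMinus n p 0 x t L,
          ENNReal.ofReal (w z * max (Real.log (w z / (K * (W / V)))) 0)) +
            ENNReal.ofReal (Real.log K) * ENNReal.ofReal (∫ z in pMinus n p 0 x t L, w z) := by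
        rw [lintegral_add_left' (by fun_prop), lintegral_const_mul' _ _ ENNReal.ofReal_ne_top,
          ofReal_integral_eq_lintegral_ofReal (pMinus_integrableOn hw.2 x t hL.le)
          (Eventually.of_forall hw.1)]
    _ ≤ (ENNReal.ofReal (M * (C₁ * ((1 + C₁) * W))) + ENNReal.ofReal (M * (C₁ * W))) +
          ENNReal.ofReal (Real.log K) * ENNReal.ofReal (C₁ * W) := by
        gcongr
        refine (lintegral_mono' (Measure.restrict_mono_ae hcover) le_rfl).trans
          ((lintegral_union_le _ _ _).trans (add_le_add (hlow.trans ?_) hup))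
        gcongr
    _ = ENNReal.ofReal ((M * C₁ + M * (C₁ * (1 + C₁)) + Real.log K * C₁) * W) := by
        rw [← ENNReal.ofReal_mul hlogK, ← ENNReal.ofReal_add (by positivity) (by positivity),
          ← ENNReal.ofReal_add (by positivity) (by positivity)]
        ring_nf
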